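/- arXiv:1308.6329 — 2 statements merged into one kernel-verified Lean document; each statement's English description precedes it below -/
import Mathlib

section
/- For each partition $\lambda$ there exists a constant $C'_\lambda > 0$ such that for any $d \geq l(\lambda)$ and any unitary matrix $U \in U(d)$, $\left| \frac{s_\lambda(U)}{s_\lambda(1_d)} - \left( \frac{\operatorname{Tr}(U)}{d} \right)^{|\lambda|} \right| \leq \frac{C'_\lambda}{d}$. -/
/-- The complete homogeneous symmetric polynomial indexed by an integer
(zero for negative index). -/
noncomputable def hsymmZ (d : ℕ) (m : ℤ) : MvPolynomial (Fin d) ℚ :=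
  if 0 ≤ m then MvPolynomial.hsymm (Fin d) ℚ m.toNat else 0

/-- The Schur polynomial in `d` variables of a partition `lam` with `ℓ` parts, defined by
the Jacobi–Trudi determinant `s_λ = det (h_{λ_i - i + j})_{1 ≤ i,j ≤ ℓ}`. -/
noncomputable def schurPoly (d ℓ : ℕ) (lam : Fin ℓ → ℕ) : MvPolynomial (Fin d) ℚ :=
  (Matrix.of fun i j : Fin ℓ => hsymmZ d ((lam i : ℤ) - (i : ℕ) + (j : ℕ))).det

theorem Multiset.countPerms_le_factorial_card {α : Type*} [DecidableEq α] (m : Multiset α) :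
    m.countPerms ≤ m.card.factorial := by
  rw [Multiset.countPerms, Finsupp.multinomial, ← Multiset.toFinsupp_sum_eq m]
  exact Nat.div_le_self _ _

theorem Nat.ascFactorial_le_pow_add_mul_pow (n : ℕ) : ∃ K : ℕ, ∀ d : ℕ, 0 < d →
    d * d.ascFactorial n ≤ d ^ (n + 1) + K * d ^ n := by
  induction n with
  | zero => exact ⟨0, fun d _ => by simp⟩
  | succ n ih =>
    obtain ⟨K, hK⟩ := ih
    refine ⟨K + n + n * K, fun d hd => ?_⟩
    have h1 : n * K * d ^ n ≤ n * K * d ^ (n + 1) :=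
      Nat.mul_le_mul_left _ (Nat.pow_le_pow_right hd (Nat.le_succ n))
    calc d * d.ascFactorial (n + 1) = (d + n) * (d * d.ascFactorial n) := by
          rw [Nat.ascFactorial_succ]; ring
      _ ≤ (d + n) * (d ^ (n + 1) + K * d ^ n) := Nat.mul_le_mul_left _ (hK d hd)
      _ = d ^ (n + 2) + (K + n) * d ^ (n + 1) + n * K * d ^ n := by ring
      _ ≤ d ^ (n + 2) + (K + n) * d ^ (n + 1) + n * K * d ^ (n + 1) := by gcongr
      _ = _ := by ring

theorem norm_factorial_mul_aeval_hsymm_sub_le {d : ℕ} (n : ℕ) (x : Fin d → ℂ)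
    (hx : ∀ i, ‖x i‖ = 1) :
    ‖(n.factorial : ℂ) * MvPolynomial.aeval x (MvPolynomial.hsymm (Fin d) ℚ n)
      - (∑ i, x i) ^ n‖ ≤ (d.ascFactorial n : ℝ) - (d : ℝ) ^ n := by
  have hle (k : Sym (Fin d) n) : k.1.countPerms ≤ n.factorial := by
    simpa [k.2] using Multiset.countPerms_le_factorial_card k.1
  have hnorm (k : Sym (Fin d) n) : ‖(k.1.map x).prod‖ = 1 := by
    have h := Multiset.prod_hom' k.1 (normHom : ℂ →*₀ ℝ) x
    change (k.1.map fun i => ‖x i‖).prod = ‖(k.1.map x).prod‖ at h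
    rw [← h]
    simp [hx]
  have hcount : (d : ℝ) ^ n = ∑ k : Sym (Fin d) n, (k.1.countPerms : ℝ) := by
    have := Finset.sum_pow (s := (Finset.univ : Finset (Fin d))) (fun _ => (1 : ℝ)) n
    simpa [Finset.sym_univ] using this
  have hcard : (d.ascFactorial n : ℝ) = ∑ _k : Sym (Fin d) n, (n.factorial : ℝ) := by
    rw [Finset.sum_const, Finset.card_univ, Sym.card_sym_eq_choose, Fintype.card_fin,
      Nat.ascFactorial_eq_factorial_mul_choose', nsmul_eq_mul]
    push_cast
    ring
  have haeval : MvPolynomial.aeval x (MvPolynomial.hsymm (Fin d) ℚ n)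
      = ∑ k : Sym (Fin d) n, (k.1.map x).prod := by
    rw [MvPolynomial.hsymm, map_sum]
    refine Finset.sum_congr rfl fun k _ => ?_
    rw [map_multiset_prod, Multiset.map_map]
    simp
  rw [haeval, Finset.sum_pow, Finset.sym_univ, Finset.mul_sum, ← Finset.sum_sub_distrib, hcount,
    hcard, ← Finset.sum_sub_distrib]
  refine norm_sum_le_of_le _ fun k _ => ?_
  rw [← sub_mul, norm_mul, hnorm, mul_one]
  have h : (n.factorial : ℂ) - (k.1.countPerms : ℂ)
      = ((((n.factorial : ℝ) - (k.1.countPerms : ℝ) : ℝ)) : ℂ) := by push_cast; rfl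
  rw [h, Complex.norm_real, Real.norm_of_nonneg]
  exact sub_nonneg.2 (by exact_mod_cast hle k)

/-- The complete homogeneous symmetric polynomial is asymptotically a multiple of a power
of the trace. -/
theorem exists_norm_aeval_hsymm_div_sub_le (n : ℕ) : ∃ K : ℝ, 0 ≤ K ∧ ∀ d : ℕ, 0 < d →
    ∀ x : Fin d → ℂ, (∀ i, ‖x i‖ = 1) →
      ‖MvPolynomial.aeval x (MvPolynomial.hsymm (Fin d) ℚ n) * ((d : ℂ)⁻¹) ^ n
        - (n.factorial : ℂ)⁻¹ * ((∑ i, x i) / d) ^ n‖ ≤ K / d := by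
  obtain ⟨K, hK⟩ := Nat.ascFactorial_le_pow_add_mul_pow n
  refine ⟨K, K.cast_nonneg, fun d hd x hx => ?_⟩
  have hd' : (0 : ℝ) < d := by exact_mod_cast hd
  have hdc : (d : ℂ) ≠ 0 := by exact_mod_cast hd.ne'
  have hf : (n.factorial : ℂ) ≠ 0 := by exact_mod_cast n.factorial_ne_zero
  have hf1 : (1 : ℝ) ≤ n.factorial := by exact_mod_cast n.factorial_pos
  have h1 := norm_factorial_mul_aeval_hsymm_sub_le n x hx
  have h2 : (d : ℝ) * d.ascFactorial n ≤ d ^ (n + 1) + K * d ^ n := by exact_mod_cast hK d hd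
  set A := MvPolynomial.aeval x (MvPolynomial.hsymm (Fin d) ℚ n)
  have h3 : A * ((d : ℂ)⁻¹) ^ n - (n.factorial : ℂ)⁻¹ * ((∑ i, x i) / d) ^ n
      = (n.factorial * A - (∑ i, x i) ^ n) / (n.factorial * (d : ℂ) ^ n) := by
    rw [div_pow, inv_pow]
    field_simp
  rw [h3, norm_div, norm_mul, norm_pow, Complex.norm_natCast, Complex.norm_natCast]
  have hp : (0 : ℝ) < (d : ℝ) ^ n := by positivity
  rw [div_le_div_iff₀ (by positivity) hd']
  have hK0 : (0 : ℝ) ≤ K * d ^ n := by positivity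
  calc _ ≤ ((d.ascFactorial n : ℝ) - (d : ℝ) ^ n) * d := by gcongr
    _ ≤ K * d ^ n * 1 := by rw [pow_succ] at h2; linarith
    _ ≤ K * d ^ n * n.factorial := by gcongr
    _ = _ := by ring

theorem norm_prod_sub_prod_le_of_forall {ι : Type*} (s : Finset ι) (f g : ι → ℂ) {M ε : ℝ}
    (hf : ∀ i, ‖f i‖ ≤ M) (hg : ∀ i, ‖g i‖ ≤ M)
    (hfg : ∀ i, ‖f i - g i‖ ≤ M * ε) :
    ‖∏ i ∈ s, f i - ∏ i ∈ s, g i‖ ≤ s.card * M ^ s.card * ε := by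
  classical
  induction s using Finset.induction_on with
  | empty => simp
  | insert a s ha ih =>
    have hM0 : 0 ≤ M := (norm_nonneg _).trans (hf a)
    rw [Finset.prod_insert ha, Finset.prod_insert ha, Finset.card_insert_of_notMem ha]
    have hgp : ‖∏ i ∈ s, g i‖ ≤ M ^ s.card := by
      rw [norm_prod]
      exact (Finset.prod_le_prod (fun i _ => norm_nonneg _) fun i _ => hg i).trans_eq
        (Finset.prod_const M)
    calc ‖f a * ∏ i ∈ s, f i - g a * ∏ i ∈ s, g i‖
        = ‖f a * (∏ i ∈ s, f i - ∏ i ∈ s, g i) + (f a - g a) * ∏ i ∈ s, g i‖ := by ring_nf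
      _ ≤ ‖f a‖ * ‖∏ i ∈ s, f i - ∏ i ∈ s, g i‖ + ‖f a - g a‖ * ‖∏ i ∈ s, g i‖ := by
        rw [← norm_mul, ← norm_mul]; exact norm_add_le _ _
      _ ≤ M * (s.card * M ^ s.card * ε) + M * ε * M ^ s.card := by
        have := (norm_nonneg _).trans (hfg a)
        gcongr
        exacts [hf a, hfg a]
      _ = _ := by push_cast; ring

theorem Matrix.norm_det_sub_det_le {ι : Type*} [Fintype ι] [DecidableEq ι] (A B : Matrix ι ι ℂ)
    {M ε : ℝ} (hA : ∀ i j, ‖A i j‖ ≤ M) (hB : ∀ i j, ‖B i j‖ ≤ M)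
    (hAB : ∀ i j, ‖A i j - B i j‖ ≤ M * ε) :
    ‖A.det - B.det‖ ≤
      (Fintype.card (Equiv.Perm ι)) * (Fintype.card ι * M ^ Fintype.card ι) * ε := by
  rw [Matrix.det_apply', Matrix.det_apply', ← Finset.sum_sub_distrib, mul_assoc, ← nsmul_eq_mul,
    ← Finset.card_univ, ← Finset.sum_const]
  refine norm_sum_le_of_le _ fun σ _ => ?_
  have hs : ‖((Equiv.Perm.sign σ : ℤ) : ℂ)‖ = 1 := by
    rcases Int.units_eq_one_or (Equiv.Perm.sign σ) with h | h <;> simp [h]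
  rw [← mul_sub, norm_mul, hs, one_mul]
  exact norm_prod_sub_prod_le_of_forall Finset.univ _ _ (fun i => hA _ _) (fun i => hB _ _)
    fun i => hAB _ _

/-- Homogeneity of Jacobi–Trudi type determinants. -/
theorem det_jacobiTrudi_mul_pow {ℓ : ℕ} (lam : Fin ℓ → ℕ) (g : ℤ → ℂ) (hg : ∀ m < 0, g m = 0)
    (t : ℂ) :
    (Matrix.of fun i j : Fin ℓ => g ((lam i : ℤ) - (i : ℕ) + (j : ℕ)) *
        t ^ ((lam i : ℤ) - (i : ℕ) + (j : ℕ)).toNat).det =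
      (Matrix.of fun i j : Fin ℓ => g ((lam i : ℤ) - (i : ℕ) + (j : ℕ))).det *
        t ^ (∑ i, lam i) := by
  rw [Matrix.det_apply', Matrix.det_apply', Finset.sum_mul]
  refine Finset.sum_congr rfl fun σ _ => ?_
  rw [mul_assoc]
  congr 1
  simp only [Matrix.of_apply]
  by_cases h : ∀ i, 0 ≤ (lam (σ i) : ℤ) - (σ i : ℕ) + (i : ℕ)
  · rw [Finset.prod_mul_distrib, Finset.prod_pow_eq_pow_sum]
    congr 2
    zify
    rw [Finset.sum_congr rfl fun i _ => Int.toNat_of_nonneg (h i), Finset.sum_add_distrib,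
      Finset.sum_sub_distrib, Equiv.sum_comp σ fun i => (lam i : ℤ),
      Equiv.sum_comp σ fun i => ((i : ℕ) : ℤ)]
    ring
  · push Not at h
    obtain ⟨i, hi⟩ := h
    rw [Finset.prod_eq_zero (Finset.mem_univ i) (by rw [hg _ hi, zero_mul]),
      Finset.prod_eq_zero (Finset.mem_univ i) (hg _ hi), zero_mul]

/-- The reciprocal factorial, extended by zero to negative integers. -/
noncomputable def invFactorialZ (m : ℤ) : ℂ := if 0 ≤ m then (m.toNat.factorial : ℂ)⁻¹ else 0

theorem norm_invFactorialZ_le_one (m : ℤ) : ‖invFactorialZ m‖ ≤ 1 := by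
  unfold invFactorialZ
  split_ifs
  · rw [norm_inv, Complex.norm_natCast]
    exact inv_le_one_of_one_le₀ (by exact_mod_cast m.toNat.factorial_pos)
  · simp

theorem invFactorialZ_sub (l k : ℕ) :
    invFactorialZ ((l : ℤ) - k) = (l.factorial : ℂ)⁻¹ * l.descFactorial k := by
  unfold invFactorialZ
  split_ifs with h
  · have hk : k ≤ l := by omega
    have h1 : ((l : ℤ) - k).toNat = l - k := by omega
    have h2 : (l.factorial : ℂ) = (l - k).factorial * l.descFactorial k := by
      exact_mod_cast (Nat.factorial_mul_descFactorial hk).symm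
    have h3 : ((l - k).factorial : ℂ) ≠ 0 := by exact_mod_cast Nat.factorial_ne_zero _
    have h4 : (l.factorial : ℂ) ≠ 0 := by exact_mod_cast Nat.factorial_ne_zero _
    rw [h1]
    field_simp
    exact h2
  · rw [Nat.descFactorial_eq_zero_iff_lt.2 (by omega)]
    simp

theorem det_invFactorialZ_ne_zero {ℓ : ℕ} (lam : Fin ℓ → ℕ)
    (hmono : ∀ i j : Fin ℓ, i ≤ j → lam j ≤ lam i) :
    (Matrix.of fun i j : Fin ℓ => invFactorialZ ((lam i : ℤ) - (i : ℕ) + (j : ℕ))).det ≠ 0 := by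
  let l : Fin ℓ → ℕ := fun i => lam i.rev + i
  have hl : StrictMono l := fun i j hij => by
    have := hmono _ _ (Fin.rev_le_rev.2 hij.le)
    have h' : (i : ℕ) < j := hij
    simp only [l]
    omega
  have hV : (Matrix.vandermonde fun i => (l i : ℂ)).det ≠ 0 :=
    Matrix.det_vandermonde_ne_zero_iff.2 (Nat.cast_injective.comp hl.injective)
  rw [Matrix.det_eval_matrixOfPolynomials_eq_det_vandermonde _
    (fun i : Fin ℓ => descPochhammer ℂ i) (fun i => descPochhammer_natDegree ℂ i)
    (fun i => monic_descPochhammer ℂ i)] at hV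
  rw [← Matrix.det_submatrix_equiv_self Fin.revPerm]
  have hentry : (Matrix.of fun i j : Fin ℓ =>
      invFactorialZ ((lam i : ℤ) - (i : ℕ) + (j : ℕ))).submatrix Fin.revPerm Fin.revPerm =
      Matrix.of fun i j : Fin ℓ => ((l i).factorial : ℂ)⁻¹ *
        (Matrix.of fun i j : Fin ℓ => (descPochhammer ℂ j).eval (l i : ℂ)) i j := by
    ext i j
    simp only [Matrix.submatrix_apply, Matrix.of_apply, Fin.revPerm_apply,
      descPochhammer_eval_eq_descFactorial]
    rw [← invFactorialZ_sub]
    congr 1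
    simp only [l, Fin.val_rev]
    omega
  rw [hentry, Matrix.det_mul_column]
  exact mul_ne_zero (Finset.prod_ne_zero_iff.2 fun i _ =>
    inv_ne_zero (by exact_mod_cast Nat.factorial_ne_zero _)) hV

theorem aeval_schurPoly {d ℓ : ℕ} (lam : Fin ℓ → ℕ) (x : Fin d → ℂ) :
    MvPolynomial.aeval x (schurPoly d ℓ lam) = (Matrix.of fun i j : Fin ℓ =>
      MvPolynomial.aeval x (hsymmZ d ((lam i : ℤ) - (i : ℕ) + (j : ℕ)))).det := by
  rw [schurPoly, AlgHom.map_det]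
  rfl

/-- The Schur polynomial is asymptotically a multiple of a power of the trace. -/
theorem exists_norm_aeval_schurPoly_div_sub_le {ℓ : ℕ} (lam : Fin ℓ → ℕ) :
    ∃ K : ℝ, 0 ≤ K ∧ ∀ d : ℕ, 0 < d → ∀ x : Fin d → ℂ, (∀ i, ‖x i‖ = 1) →
      ‖MvPolynomial.aeval x (schurPoly d ℓ lam) * ((d : ℂ)⁻¹) ^ (∑ i, lam i) -
        (Matrix.of fun i j : Fin ℓ => invFactorialZ ((lam i : ℤ) - (i : ℕ) + (j : ℕ))).det *
          ((∑ i, x i) / d) ^ (∑ i, lam i)‖ ≤ K / d := by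
  choose K hK0 hK using exists_norm_aeval_hsymm_div_sub_le
  let S : ℝ := ∑ i : Fin ℓ, ∑ j : Fin ℓ, K ((lam i : ℤ) - (i : ℕ) + (j : ℕ)).toNat
  have hS0 : 0 ≤ S := Finset.sum_nonneg fun i _ => Finset.sum_nonneg fun j _ => hK0 _
  have hS (i j : Fin ℓ) : K ((lam i : ℤ) - (i : ℕ) + (j : ℕ)).toNat ≤ S :=
    (Finset.single_le_sum (f := fun j : Fin ℓ => K ((lam i : ℤ) - (i : ℕ) + (j : ℕ)).toNat)
      (fun j _ => hK0 _) (Finset.mem_univ j)).trans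
      (Finset.single_le_sum
        (f := fun i : Fin ℓ => ∑ j : Fin ℓ, K ((lam i : ℤ) - (i : ℕ) + (j : ℕ)).toNat)
        (fun i _ => Finset.sum_nonneg fun j _ => hK0 _) (Finset.mem_univ i))
  refine ⟨Fintype.card (Equiv.Perm (Fin ℓ)) *
    (Fintype.card (Fin ℓ) * (1 + S) ^ Fintype.card (Fin ℓ)), by positivity, fun d hd x hx => ?_⟩
  have hd1 : (1 : ℝ) ≤ d := by exact_mod_cast hd
  have ht : ‖(∑ i, x i) / (d : ℂ)‖ ≤ 1 := by
    rw [norm_div, Complex.norm_natCast]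
    refine div_le_one_of_le₀ ((norm_sum_le _ _).trans ?_) (by positivity)
    simp [hx]
  rw [aeval_schurPoly, ← det_jacobiTrudi_mul_pow lam
    (fun m => MvPolynomial.aeval x (hsymmZ d m)) (fun m hm => by simp [hsymmZ, hm.not_ge]),
    ← det_jacobiTrudi_mul_pow lam invFactorialZ (fun m hm => by simp [invFactorialZ, hm.not_ge]),
    div_eq_mul_inv]
  have hdiff (i j : Fin ℓ) : ‖MvPolynomial.aeval x (hsymmZ d ((lam i : ℤ) - (i : ℕ) + (j : ℕ))) *
        ((d : ℂ)⁻¹) ^ ((lam i : ℤ) - (i : ℕ) + (j : ℕ)).toNat -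
      invFactorialZ ((lam i : ℤ) - (i : ℕ) + (j : ℕ)) *
        ((∑ i, x i) / (d : ℂ)) ^ ((lam i : ℤ) - (i : ℕ) + (j : ℕ)).toNat‖ ≤ S * (d : ℝ)⁻¹ := by
    unfold hsymmZ invFactorialZ
    split_ifs with h
    · refine (hK _ d hd x hx).trans ?_
      rw [div_eq_mul_inv]
      exact mul_le_mul_of_nonneg_right (hS i j) (by positivity)
    · simp only [map_zero, zero_mul, sub_zero, norm_zero]
      positivity
  have hB (i j : Fin ℓ) : ‖invFactorialZ ((lam i : ℤ) - (i : ℕ) + (j : ℕ)) *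
        ((∑ i, x i) / (d : ℂ)) ^ ((lam i : ℤ) - (i : ℕ) + (j : ℕ)).toNat‖ ≤ 1 := by
    rw [norm_mul, norm_pow]
    exact mul_le_one₀ (norm_invFactorialZ_le_one _) (by positivity)
      (pow_le_one₀ (norm_nonneg _) ht)
  refine Matrix.norm_det_sub_det_le (M := 1 + S) _ _ (fun i j => ?_)
    (fun i j => (hB i j).trans (by linarith)) (fun i j => (hdiff i j).trans ?_)
  · have h1 : S * (d : ℝ)⁻¹ ≤ S := mul_le_of_le_one_right hS0 (inv_le_one_of_one_le₀ hd1)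
    exact (norm_le_norm_add_norm_sub' _ _).trans
      (add_le_add (hB i j) ((hdiff i j).trans h1))
  · gcongr
    linarith

/-- for each partition `λ` there is `C' > 0` such that for all `d ≥ l(λ)`
and every unitary `U ∈ U(d)` (represented by its eigenvalue tuple `x`, `|x i| = 1`),
`|s_λ(U)/s_λ(1_d) - (Tr U / d)^{|λ|}| ≤ C'/d`. -/
theorem stmt_7 (ℓ : ℕ) (lam : Fin ℓ → ℕ)
    (hmono : ∀ i j : Fin ℓ, i ≤ j → lam j ≤ lam i)
    (hpos : ∀ i, 0 < lam i) :
    ∃ C' : ℝ, 0 < C' ∧ ∀ d : ℕ, ℓ ≤ d → 0 < d → ∀ x : Fin d → ℂ, (∀ i, ‖x i‖ = 1) →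
      ‖(MvPolynomial.aeval x) (schurPoly d ℓ lam) /
            ((MvPolynomial.eval (fun _ => (1 : ℚ)) (schurPoly d ℓ lam) : ℚ) : ℂ) -
          ((∑ i, x i) / (d : ℂ)) ^ (∑ i, lam i)‖ ≤ C' / d := by
  obtain ⟨K, hK0, hK⟩ := exists_norm_aeval_schurPoly_div_sub_le lam
  have hc := det_invFactorialZ_ne_zero lam hmono
  set c := (Matrix.of fun i j : Fin ℓ => invFactorialZ ((lam i : ℤ) - (i : ℕ) + (j : ℕ))).det
  set N := ∑ i, lam i
  have hc0 : 0 < ‖c‖ := norm_pos_iff.2 hc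
  -- For small `d` it suffices that the ratio is bounded.
  let s : ℕ → ℂ := fun d => ((MvPolynomial.eval (fun _ => (1 : ℚ)) (schurPoly d ℓ lam) : ℚ) : ℂ)
  let T : ℕ → ℝ := fun d => ((K + ‖c‖) / ‖s d * ((d : ℂ)⁻¹) ^ N‖ + 1) * d
  have hT0 (d : ℕ) : 0 ≤ T d := by positivity
  obtain ⟨D, hD⟩ := exists_nat_ge (2 * K / ‖c‖)
  let C : ℝ := 4 * K / ‖c‖ + ∑ d ∈ Finset.range D, T d + 1
  have hsum0 : 0 ≤ ∑ d ∈ Finset.range D, T d := Finset.sum_nonneg fun d _ => hT0 d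
  have hKc : 0 ≤ 4 * K / ‖c‖ := by positivity
  refine ⟨C, by positivity, fun d _ hd x hx => ?_⟩
  have hd0 : (0 : ℝ) < d := by exact_mod_cast hd
  have hd1 : (1 : ℝ) ≤ d := by exact_mod_cast hd
  have hdc : (d : ℂ) ≠ 0 := by exact_mod_cast hd.ne'
  have hpow : ((d : ℂ)⁻¹) ^ N ≠ 0 := pow_ne_zero _ (inv_ne_zero hdc)
  have hs : s d = MvPolynomial.aeval (fun _ => (1 : ℂ)) (schurPoly d ℓ lam) := by
    have := MvPolynomial.aeval_algebraMap_apply ℂ (fun _ : Fin d => (1 : ℚ)) (schurPoly d ℓ lam)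
    simpa [s, MvPolynomial.aeval_eq_eval, Function.comp_def] using this.symm
  have ht : ‖((∑ i, x i) / (d : ℂ)) ^ N‖ ≤ 1 := by
    rw [norm_pow]
    refine pow_le_one₀ (norm_nonneg _) ?_
    rw [norm_div, Complex.norm_natCast]
    refine div_le_one_of_le₀ ((norm_sum_le _ _).trans ?_) (by positivity)
    simp [hx]
  have hx1 := hK d hd x hx
  have hone := hK d hd (fun _ => 1) (by simp)
  rw [← hs] at hone
  simp only [Finset.sum_const, Finset.card_univ, Fintype.card_fin, nsmul_eq_mul, mul_one,
    div_self hdc, one_pow] at hone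
  change ‖_ / s d - _‖ ≤ _
  rw [← mul_div_mul_right _ (s d) hpow]
  set a := MvPolynomial.aeval x (schurPoly d ℓ lam) * ((d : ℂ)⁻¹) ^ N
  set b := s d * ((d : ℂ)⁻¹) ^ N
  set τ := ((∑ i, x i) / (d : ℂ)) ^ N
  by_cases hdD : d < D
  · have hTd : T d ≤ C := by
      have := Finset.single_le_sum (f := T) (fun d _ => hT0 d) (Finset.mem_range.2 hdD)
      simp only [C]
      linarith
    have ha : ‖a‖ ≤ K + ‖c‖ := by
      calc ‖a‖ ≤ ‖c * τ‖ + ‖a - c * τ‖ := norm_le_norm_add_norm_sub' _ _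
        _ ≤ ‖c‖ * 1 + K := by
          rw [norm_mul]
          gcongr
          exact hx1.trans (div_le_self hK0 hd1)
        _ = _ := by ring
    rw [le_div_iff₀ hd0]
    refine le_trans ?_ hTd
    refine mul_le_mul_of_nonneg_right ((norm_sub_le _ _).trans ?_) hd0.le
    rw [norm_div]
    gcongr
  · have hDd : (D : ℝ) ≤ d := by exact_mod_cast not_lt.1 hdD
    have hKd : K / d ≤ ‖c‖ / 2 := by
      have := hD.trans hDd
      rw [div_le_iff₀ hc0] at this
      rw [div_le_iff₀ hd0]
      linarith
    have hb2 : ‖c‖ / 2 ≤ ‖b‖ := by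
      have := norm_le_norm_add_norm_sub b c
      linarith
    have hb0 : b ≠ 0 := norm_pos_iff.1 (by linarith)
    have hnum : ‖a - τ * b‖ ≤ 2 * (K / d) := by
      calc ‖a - τ * b‖ = ‖(a - c * τ) - τ * (b - c)‖ := by ring_nf
        _ ≤ ‖a - c * τ‖ + ‖τ‖ * ‖b - c‖ := by rw [← norm_mul]; exact norm_sub_le _ _
        _ ≤ K / d + 1 * (K / d) := by gcongr
        _ = _ := by ring
    have hratio : a / b - τ = (a - τ * b) / b := by field_simp
    rw [hratio, norm_div]
    calc ‖a - τ * b‖ / ‖b‖ ≤ 2 * (K / d) / (‖c‖ / 2) := by gcongr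
      _ = 4 * K / ‖c‖ / d := by field_simp; ring
      _ ≤ C / d := by
        gcongr
        simp only [C]
        linarith
end

section
/- Fix $a = (a_1, \ldots, a_m) \in \mathbb{R}_{>0}^m$ and define the Markov operator $P$ on bounded functions on $\mathbb{Z}_{\geq 0}^m$ by $P(f)(x) = \sum_{y \geq x} \prod_{i=1}^m \frac{e^{-a_i} a_i^{y_i - x_i}}{(y_i - x_i)!} f(y)$. If $\{f_n\}_{n \geq 1}$ is a uniformly bounded sequence of functions with $P(f_{n+1}) = f_n$ for all $n$, then each $f_n$ is constant, and all $f_n$ are equal to the same constant. -/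
/-- The Markov operator of the multidimensional Poisson random walk on `ℤ≥0^m`
with parameter vector `a`. -/
noncomputable def poissonMarkovOp {m : ℕ} (a : Fin m → ℝ) (f : (Fin m → ℕ) → ℝ)
    (x : Fin m → ℕ) : ℝ :=
  ∑' y : Fin m → ℕ,
    (if ∀ i, x i ≤ y i then
        ∏ i, Real.exp (-(a i)) * (a i) ^ (y i - x i) / ((y i - x i).factorial : ℝ)
      else 0) * f y

/-- A bounded sequence of functions, each obtained from the next by averaging against a strictly
positive probability weight on a commutative monoid, does not increase under translation. -/
theorem apply_add_le_of_forall_hasSum {G : Type*} [AddCommMonoid G] {w : G → ℝ}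
    (hw : ∀ z, 0 < w z) (hw1 : HasSum w 1) {f : ℕ → G → ℝ} {C : ℝ} (hbd : ∀ n x, |f n x| ≤ C)
    (hf : ∀ n x, HasSum (fun z => w z * f (n + 1) (x + z)) (f n x)) (n : ℕ) (x v : G) :
    f n (x + v) ≤ f n x := by
  set g : ℕ × G → ℝ := fun p => f p.1 (p.2 + v) - f p.1 p.2 with hg
  have hgC : ∀ p, g p ≤ 2 * C := fun p => by
    have h1 := abs_le.mp (hbd p.1 (p.2 + v))
    have h2 := abs_le.mp (hbd p.1 p.2)
    simp only [hg]
    linarith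
  have hbdd : BddAbove (Set.range g) := ⟨2 * C, by rintro _ ⟨p, rfl⟩; exact hgC p⟩
  set M := ⨆ p, g p
  have hgM : ∀ p, g p ≤ M := le_ciSup hbdd
  suffices hM0 : M ≤ 0 by
    have := hgM (n, x)
    simp only [hg] at this
    linarith
  by_contra! hMpos
  obtain ⟨N, hN⟩ := exists_nat_gt ((2 * C + 1) / M)
  rw [div_lt_iff₀ hMpos] at hN
  set S := ∑ j ∈ Finset.range N, (w (j • v))⁻¹ with hS
  have hS0 : 0 ≤ S := Finset.sum_nonneg fun j _ => (inv_pos.mpr (hw _)).le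
  have : Nonempty (ℕ × G) := ⟨(n, x)⟩
  obtain ⟨⟨k, y⟩, hky⟩ := exists_lt_of_lt_ciSup
    (show M - (S + 1)⁻¹ < ⨆ p, g p from sub_lt_self _ (by positivity))
  have hstep : ∀ j : ℕ, M - (S + 1)⁻¹ * (w (j • v))⁻¹ ≤ g (k + 1, y + j • v) := fun j => by
    have hsum : HasSum (fun z => w z * (M - g (k + 1, y + z))) (M - g (k, y)) := by
      convert! (hw1.mul_right M).sub ((hf k (y + v)).sub (hf k y)) using 1
      · funext z
        simp only [hg, add_right_comm y z v]
        ring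
      · simp only [hg, one_mul]
    have hle := le_hasSum hsum (j • v) fun z _ =>
      mul_nonneg (hw z).le (sub_nonneg.mpr (hgM _))
    have : M - g (k + 1, y + j • v) ≤ (S + 1)⁻¹ * (w (j • v))⁻¹ := by
      rw [← div_eq_mul_inv, le_div_iff₀ (hw _)]
      linarith
    linarith
  have htel : ∑ j ∈ Finset.range N, g (k + 1, y + j • v) = f (k + 1) (y + N • v) - f (k + 1) y := by
    have := Finset.sum_range_sub (fun j => f (k + 1) (y + j • v)) N
    simpa [hg, add_assoc, succ_nsmul] using this
  have hsum := Finset.sum_le_sum fun j (_ : j ∈ Finset.range N) => hstep j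
  rw [htel, Finset.sum_sub_distrib, ← Finset.mul_sum, ← hS] at hsum
  have hSle : (S + 1)⁻¹ * S ≤ 1 := by
    rw [inv_mul_le_iff₀ (by positivity)]
    linarith
  have h1 := abs_le.mp (hbd (k + 1) (y + N • v))
  have h2 := abs_le.mp (hbd (k + 1) y)
  simp only [Finset.sum_const, Finset.card_range, nsmul_eq_mul] at hsum
  linarith

/-- A bounded sequence of functions, each obtained from the next by averaging against a strictly
positive probability weight on a commutative monoid, consists of one single constant function. -/
theorem exists_forall_eq_of_forall_hasSum {G : Type*} [AddCommMonoid G] {w : G → ℝ}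
    (hw : ∀ z, 0 < w z) (hw1 : HasSum w 1) {f : ℕ → G → ℝ} {C : ℝ} (hbd : ∀ n x, |f n x| ≤ C)
    (hf : ∀ n x, HasSum (fun z => w z * f (n + 1) (x + z)) (f n x)) :
    ∃ c, ∀ n x, f n x = c := by
  have hconst : ∀ n x, f n x = f n 0 := fun n x => by
    have hle := apply_add_le_of_forall_hasSum hw hw1 hbd hf n 0 x
    have hge := apply_add_le_of_forall_hasSum (f := fun n x => -f n x) hw hw1
      (by simpa using hbd) (fun n x => by simpa using (hf n x).neg) n 0 x
    rw [zero_add] at hle hge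
    linarith
  have hsucc : ∀ n, f (n + 1) 0 = f n 0 := fun n => by
    have h := hf n 0
    simp only [hconst (n + 1)] at h
    simpa using (hw1.mul_right (f (n + 1) 0)).unique h
  refine ⟨f 0 0, fun n x => (hconst n x).trans ?_⟩
  induction n with
  | zero => rfl
  | succ n ih => rw [hsucc, ih]

/-- The joint mass function of independent Poisson variables has total mass one. -/
theorem hasSum_prod_poisson {ι : Type*} [Fintype ι] (a : ι → ℝ) (ha : ∀ i, 0 ≤ a i) :
    HasSum (fun z : ι → ℕ => ∏ i, Real.exp (-a i) * a i ^ z i / ((z i).factorial : ℝ)) 1 := by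
  lift a to ι → NNReal using ha
  set μ : MeasureTheory.Measure (ι → ℕ) :=
    MeasureTheory.Measure.pi fun i => ProbabilityTheory.poissonMeasure (a i) with hμ
  have hsingle : ∀ z : ι → ℕ, (μ {z}).toReal =
      ∏ i, Real.exp (-(a i : ℝ)) * (a i : ℝ) ^ z i / ((z i).factorial : ℝ) := fun z => by
    rw [hμ, MeasureTheory.Measure.pi_singleton, ENNReal.toReal_prod]
    exact Finset.prod_congr rfl fun i _ => ProbabilityTheory.poissonMeasure_real_singleton _ _
  have hprob : MeasureTheory.IsProbabilityMeasure μ := by rw [hμ]; infer_instance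
  have htsum : ∑' z, μ {z} = 1 := by
    rw [← hprob.measure_univ]
    simpa using μ.tsum_indicator_apply_singleton Set.univ MeasurableSet.univ
  have h := (ENNReal.summable_toReal (f := fun z => μ {z}) (by simp [htsum])).hasSum
  rw [← ENNReal.tsum_toReal_eq fun z => MeasureTheory.measure_ne_top μ {z}, htsum,
    ENNReal.toReal_one] at h
  simpa only [hsingle] using h

/-- The Poisson Markov operator, written as an average over increments. -/
theorem poissonMarkovOp_eq_tsum_add {m : ℕ} (a : Fin m → ℝ) (f : (Fin m → ℕ) → ℝ)
    (x : Fin m → ℕ) :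
    poissonMarkovOp a f x =
      ∑' z : Fin m → ℕ, (∏ i, Real.exp (-a i) * a i ^ z i / ((z i).factorial : ℝ)) * f (x + z) := by
  rw [poissonMarkovOp, ← (add_right_injective x).tsum_eq]
  · simp
  · intro y hy
    have hxy : x ≤ y := by
      by_contra h
      exact hy (by simp only [if_neg (show ¬∀ i, x i ≤ y i from h), zero_mul])
    exact ⟨y - x, add_tsub_cancel_of_le hxy⟩

/-- The tail boundary of the multidimensional Poisson random walk is
trivial: any uniformly bounded sequence `f n` with `P (f (n+1)) = f n` consists of one
single constant function. -/
theorem stmt_15 (m : ℕ) (a : Fin m → ℝ) (ha : ∀ i, 0 < a i)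
    (f : ℕ → (Fin m → ℕ) → ℝ) (C : ℝ) (hbd : ∀ n x, |f n x| ≤ C)
    (hP : ∀ n, poissonMarkovOp a (f (n + 1)) = f n) :
    ∃ c : ℝ, ∀ n x, f n x = c := by
  have hw : ∀ z : Fin m → ℕ,
      0 < ∏ i, Real.exp (-a i) * a i ^ z i / ((z i).factorial : ℝ) := fun z =>
    Finset.prod_pos fun i _ => by have := ha i; positivity
  have hw1 := hasSum_prod_poisson a fun i => (ha i).le
  refine exists_forall_eq_of_forall_hasSum hw hw1 hbd fun n x => ?_
  rw [← hP n, poissonMarkovOp_eq_tsum_add]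
  refine Summable.hasSum (.of_norm_bounded (hw1.summable.mul_right C) fun z => ?_)
  rw [norm_mul, Real.norm_of_nonneg (hw z).le, Real.norm_eq_abs]
  exact mul_le_mul_of_nonneg_left (hbd _ _) (hw z).le
end
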